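/- Let θ₁, θ₂ be real numbers such that 1, θ₁, θ₂ are linearly independent over ℤ, let L(x) = x₀ + x₁θ₁ + x₂θ₂, let P and F be linear forms on ℝ³ such that L, P, F are linearly independent, and let (x_ν) be the sequence of minimal points of L with X_ν = |x_ν|, L_ν = L(x_ν), P_ν = P(x_ν). Let α > 2, let r > 0 satisfy r < α² − α + 1, suppose L_j ≤ X_{j+1}^{−α} for all indices j, and let β₀ > 0 and c₀ > 0. Suppose that for arbitrarily large ν there exists k > ν such that: L_ν ≥ c₀·X_ν^{−β₀}; the triples x_{ν−1}, x_ν, x_{ν+1} and x_{k−1}, x_k, x_{k+1} are each linearly independent; every x_j with ν ≤ j ≤ k lies in the two-dimensional lattice ℤ³ ∩ span(x_ν, x_{ν+1}); and |P_ν| ≤ L_ν·X_ν^r, |P_{k−1}| ≤ L_{k−1}·X_{k−1}^r, |P_k| ≤ L_k·X_k^r. Then r ≥ α² + 1 − β₀/(α − 1). -/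

import Mathlib

/-- Euclidean norm of an integer vector in `ℤ³`. -/
noncomputable def enormZ (v : Fin 3 → ℤ) : ℝ :=
  Real.sqrt ((v 0 : ℝ) ^ 2 + (v 1 : ℝ) ^ 2 + (v 2 : ℝ) ^ 2)

/-- The real vector associated to an integer vector. -/
def toR (v : Fin 3 → ℤ) : Fin 3 → ℝ := fun i => (v i : ℝ)

/-- The rational vector associated to an integer vector. -/
def toQ (v : Fin 3 → ℤ) : Fin 3 → ℚ := fun i => (v i : ℚ)

/-- The linear form `L(x) = x₀ + x₁ θ₁ + x₂ θ₂` on `ℝ³`. -/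
noncomputable def Lform (θ₁ θ₂ : ℝ) : (Fin 3 → ℝ) →ₗ[ℝ] ℝ :=
  LinearMap.proj 0 + θ₁ • LinearMap.proj 1 + θ₂ • LinearMap.proj 2

/-- The determinant of the `3 × 3` matrix with rows `u`, `v`, `w`, written out. -/
def tripleDet {R : Type*} [CommRing R] (u v w : Fin 3 → R) : R :=
  u 0 * (v 1 * w 2 - v 2 * w 1) - u 1 * (v 0 * w 2 - v 2 * w 0) + u 2 * (v 0 * w 1 - v 1 * w 0)

lemma det_of_eq_tripleDet {R : Type*} [CommRing R] (u v w : Fin 3 → R) :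
    (Matrix.of ![u, v, w]).det = tripleDet u v w := by
  simp [Matrix.det_fin_three, tripleDet]
  ring

lemma tripleDet_ne_zero_of_linearIndependent {𝕜 : Type*} [Field 𝕜] {u v w : Fin 3 → 𝕜}
    (h : LinearIndependent 𝕜 ![u, v, w]) : tripleDet u v w ≠ 0 := by
  rw [← det_of_eq_tripleDet]
  have h' : LinearIndependent 𝕜 (Matrix.of ![u, v, w]).row := h
  rw [Matrix.linearIndependent_rows_iff_isUnit, Matrix.isUnit_iff_isUnit_det] at h'
  exact h'.ne_zero

lemma one_le_abs_tripleDet {u v w : Fin 3 → ℤ}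
    (h : tripleDet (toR u) (toR v) (toR w) ≠ 0) :
    1 ≤ |tripleDet (toR u) (toR v) (toR w)| := by
  have e : tripleDet (toR u) (toR v) (toR w) = ((tripleDet u v w : ℤ) : ℝ) := by
    simp [tripleDet, toR]
  rw [e] at h ⊢
  exact_mod_cast Int.one_le_abs (by exact_mod_cast h)

lemma tripleDet_toR_ne_zero {u v w : Fin 3 → ℤ}
    (h : LinearIndependent ℚ ![toQ u, toQ v, toQ w]) :
    tripleDet (toR u) (toR v) (toR w) ≠ 0 := by
  have h1 := tripleDet_ne_zero_of_linearIndependent h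
  have e1 : tripleDet (toQ u) (toQ v) (toQ w) = ((tripleDet u v w : ℤ) : ℚ) := by
    simp [tripleDet, toQ]
  have e2 : tripleDet (toR u) (toR v) (toR w) = ((tripleDet u v w : ℤ) : ℝ) := by
    simp [tripleDet, toR]
  rw [e1] at h1
  rw [e2]
  exact_mod_cast h1

lemma linearMap_apply_fin_three (f : (Fin 3 → ℝ) →ₗ[ℝ] ℝ) (u : Fin 3 → ℝ) :
    f u = u 0 * f (Pi.single 0 1) + u 1 * f (Pi.single 1 1) + u 2 * f (Pi.single 2 1) := by
  conv_lhs => rw [LinearMap.pi_apply_eq_sum_univ f u]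
  have hs : ∀ i : Fin 3, (fun j => if i = j then (1 : ℝ) else 0) = Pi.single i 1 := by
    intro i
    ext j
    simp [Pi.single_apply, eq_comm]
  simp [Fin.sum_univ_three, hs]

lemma abs_apply_le_enormZ (v : Fin 3 → ℤ) (i : Fin 3) : |toR v i| ≤ enormZ v := by
  apply Real.abs_le_sqrt
  fin_cases i <;> simp [toR] <;> nlinarith [sq_nonneg (v 0 : ℝ), sq_nonneg (v 1 : ℝ),
    sq_nonneg (v 2 : ℝ)]

lemma exists_abs_linearMap_le (f : (Fin 3 → ℝ) →ₗ[ℝ] ℝ) :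
    ∃ K : ℝ, 0 < K ∧ ∀ v : Fin 3 → ℤ, |f (toR v)| ≤ K * enormZ v := by
  refine ⟨|f (Pi.single 0 1)| + |f (Pi.single 1 1)| + |f (Pi.single 2 1)| + 1, by positivity,
    fun v => ?_⟩
  have hE : 0 ≤ enormZ v := Real.sqrt_nonneg _
  have hb : ∀ i : Fin 3, |toR v i * f (Pi.single i 1)| ≤ enormZ v * |f (Pi.single i 1)| := by
    intro i
    rw [abs_mul]
    exact mul_le_mul_of_nonneg_right (abs_apply_le_enormZ v i) (abs_nonneg _)
  rw [linearMap_apply_fin_three f]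
  linarith [abs_add_three (toR v 0 * f (Pi.single 0 1)) (toR v 1 * f (Pi.single 1 1))
    (toR v 2 * f (Pi.single 2 1)), hb 0, hb 1, hb 2]

/-- Evaluating three independent linear forms at three vectors multiplies the determinant of the
vectors by a nonzero constant. -/
lemma exists_tripleDet_forms {f g h : (Fin 3 → ℝ) →ₗ[ℝ] ℝ} (hi : LinearIndependent ℝ ![f, g, h]) :
    ∃ D : ℝ, D ≠ 0 ∧ ∀ u v w : Fin 3 → ℝ,
      tripleDet ![f u, g u, h u] ![f v, g v, h v] ![f w, g w, h w] = D * tripleDet u v w := by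
  let c : ((Fin 3 → ℝ) →ₗ[ℝ] ℝ) → (Fin 3 → ℝ) := fun φ i => φ (Pi.single i 1)
  refine ⟨tripleDet (c f) (c g) (c h), ?_, fun u v w => ?_⟩
  · apply tripleDet_ne_zero_of_linearIndependent
    rw [Fintype.linearIndependent_iff] at hi ⊢
    intro a ha
    apply hi a
    ext i
    have := congrFun ha i
    simpa [Fin.sum_univ_three, c] using this
  · rw [linearMap_apply_fin_three f u, linearMap_apply_fin_three f v, linearMap_apply_fin_three f w,
      linearMap_apply_fin_three g u, linearMap_apply_fin_three g v, linearMap_apply_fin_three g w,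
      linearMap_apply_fin_three h u, linearMap_apply_fin_three h v, linearMap_apply_fin_three h w]
    simp [tripleDet, c]
    ring

/-- Vectors `v`, `w` in the span of `a`, `b` have all their determinants proportional to those of
`a`, `b`. -/
lemma exists_tripleDet_eq_mul {a b v w : Fin 3 → ℝ} (hv : v ∈ Submodule.span ℝ {a, b})
    (hw : w ∈ Submodule.span ℝ {a, b}) :
    ∃ m : ℝ, ∀ y, tripleDet y v w = m * tripleDet y a b := by
  obtain ⟨s, t, rfl⟩ := Submodule.mem_span_pair.1 hv
  obtain ⟨p, q, rfl⟩ := Submodule.mem_span_pair.1 hw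
  refine ⟨s * q - t * p, fun y => ?_⟩
  simp [tripleDet]
  ring

lemma abs_tripleDet_le_of_Lform (θ₁ θ₂ : ℝ) (u v w : Fin 3 → ℤ)
    (huv : enormZ u ≤ enormZ v) (hvw : enormZ v ≤ enormZ w)
    (hLu : 0 ≤ Lform θ₁ θ₂ (toR u))
    (hLv : |Lform θ₁ θ₂ (toR v)| ≤ Lform θ₁ θ₂ (toR u))
    (hLw : |Lform θ₁ θ₂ (toR w)| ≤ Lform θ₁ θ₂ (toR u)) :
    |tripleDet (toR u) (toR v) (toR w)| ≤
      6 * (Lform θ₁ θ₂ (toR u) * (enormZ v * enormZ w)) := by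
  have h0 : ∀ y : Fin 3 → ℤ, 0 ≤ enormZ y := fun y => Real.sqrt_nonneg _
  have key : ∀ y z : Fin 3 → ℤ, enormZ y ≤ enormZ v → enormZ z ≤ enormZ w →
      |toR y 1 * toR z 2 - toR y 2 * toR z 1| ≤ 2 * (enormZ v * enormZ w) := by
    intro y z hy hz
    have hb : ∀ i j, |toR y i * toR z j| ≤ enormZ v * enormZ w := by
      intro i j
      rw [abs_mul]
      exact mul_le_mul ((abs_apply_le_enormZ y i).trans hy) ((abs_apply_le_enormZ z j).trans hz)
        (abs_nonneg _) (h0 v)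
    linarith [abs_sub (toR y 1 * toR z 2) (toR y 2 * toR z 1), hb 1 2, hb 2 1]
  have hL : ∀ y, Lform θ₁ θ₂ y = y 0 + θ₁ * y 1 + θ₂ * y 2 := by
    intro y
    simp [Lform]
  have e : tripleDet (toR u) (toR v) (toR w) =
      Lform θ₁ θ₂ (toR u) * (toR v 1 * toR w 2 - toR v 2 * toR w 1) +
      -(Lform θ₁ θ₂ (toR v) * (toR u 1 * toR w 2 - toR u 2 * toR w 1)) +
      Lform θ₁ θ₂ (toR w) * (toR u 1 * toR v 2 - toR u 2 * toR v 1) := by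
    rw [hL, hL, hL]
    simp only [tripleDet]
    ring
  have b1 := mul_le_mul (abs_of_nonneg hLu).le (key v w le_rfl le_rfl) (abs_nonneg _) hLu
  have b2 := mul_le_mul hLv (key u w huv le_rfl) (abs_nonneg _) hLu
  have b3 := mul_le_mul hLw (key u v huv hvw) (abs_nonneg _) hLu
  rw [← abs_mul] at b1 b2 b3
  rw [e]
  refine (abs_add_three _ _ _).trans ?_
  rw [abs_neg]
  linarith

lemma natCast_le_enormZ_sq {x : ℕ → Fin 3 → ℤ}
    (hXlt : ∀ ν, enormZ (x ν) < enormZ (x (ν + 1))) (ν : ℕ) : (ν : ℝ) ≤ enormZ (x ν) ^ 2 := by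
  have hsq : ∀ y : Fin 3 → ℤ, enormZ y ^ 2 = ((y 0 ^ 2 + y 1 ^ 2 + y 2 ^ 2 : ℤ) : ℝ) := by
    intro y
    rw [enormZ, Real.sq_sqrt (by positivity)]
    push_cast
    rfl
  induction ν with
  | zero => simpa using sq_nonneg _
  | succ n ih =>
    have h1 : enormZ (x n) ^ 2 < enormZ (x (n + 1)) ^ 2 :=
      pow_lt_pow_left₀ (hXlt n) (Real.sqrt_nonneg _) two_ne_zero
    rw [hsq] at ih h1 ⊢
    rw [hsq] at h1
    norm_cast at ih h1 ⊢
    push_cast at ih h1 ⊢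
    lia

lemma tendsto_enormZ_atTop {x : ℕ → Fin 3 → ℤ}
    (hXlt : ∀ ν, enormZ (x ν) < enormZ (x (ν + 1))) :
    Filter.Tendsto (fun ν => enormZ (x ν)) Filter.atTop Filter.atTop := by
  have h : Filter.Tendsto (fun ν => enormZ (x ν) ^ 2) Filter.atTop Filter.atTop :=
    Filter.tendsto_atTop_mono (natCast_le_enormZ_sq hXlt) tendsto_natCast_atTop_atTop
  refine (Real.tendsto_sqrt_atTop.comp h).congr fun ν => ?_
  exact Real.sqrt_sq (Real.sqrt_nonneg _)

/-- Independence of three consecutive points forces a large gap between the last two norms. -/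
lemma rpow_le_of_one_le_mul {α X Y l : ℝ} (hX : 1 ≤ X) (hY : 0 ≤ Y) (hl : l ≤ X ^ (-α))
    (h : 1 ≤ 6 * (l * (X * Y))) : X ^ (α - 1) ≤ 6 * Y := by
  have hX0 : 0 < X := by linarith
  have h1 : 1 ≤ 6 * (X ^ (-α) * (X * Y)) := h.trans (by gcongr)
  have e : X ^ (α - 1) * (X ^ (-α) * X) = 1 := by
    rw [← Real.rpow_add_one hX0.ne', ← Real.rpow_add hX0]
    simp
  have h2 := mul_le_mul_of_nonneg_left h1 (Real.rpow_nonneg hX0.le (α - 1))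
  calc X ^ (α - 1) = X ^ (α - 1) * 1 := (mul_one _).symm
    _ ≤ _ := h2
    _ = 6 * Y * (X ^ (α - 1) * (X ^ (-α) * X)) := by ring
    _ = 6 * Y := by rw [e, mul_one]

lemma rpow_neg_le_of_rpow_le {X Y s t : ℝ} (hX : 1 ≤ X) (hY : 0 < Y) (ht : 0 ≤ t)
    (h : X ^ s ≤ 6 * Y) : Y ^ (-t) ≤ 6 ^ t * X ^ (-(s * t)) := by
  have hX0 : 0 < X := by linarith
  have h1 : (X ^ s) ^ t ≤ (6 * Y) ^ t := Real.rpow_le_rpow (by positivity) h ht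
  rw [← Real.rpow_mul hX0.le, Real.mul_rpow (by norm_num) hY.le] at h1
  rw [Real.rpow_neg hY.le, Real.rpow_neg hX0.le, ← div_eq_mul_inv, inv_eq_one_div,
    div_le_div_iff₀ (by positivity) (by positivity)]
  linarith

/-- Elimination of the minors `A`, `B`, `C` from the size estimates. -/
lemma const_le_of_minor_bounds {α r β₀ c₀ K d A B C X Y Z W l p l' m n : ℝ} (hα : 2 < α)
    (hr : r < α ^ 2 - α + 1) (hc₀ : 0 < c₀) (hK : 0 < K)
    (hX : 1 ≤ X) (hXY : X ≤ Y) (hWY : W ≤ Y) (hZ : 0 < Z)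
    (hY6 : X ^ (α - 1) ≤ 6 * Y) (hZ6 : Y ^ (α - 1) ≤ 6 * Z)
    (hl' : l' ≤ X ^ (-α)) (hm : m ≤ Y ^ (-α)) (hn0 : 0 ≤ n)
    (hn : n ≤ Z ^ (-α)) (hl : 0 < l) (hcl : c₀ * X ^ (-β₀) ≤ l) (hp : |p| ≤ l * X ^ r)
    (hd : d ≤ l' * |A| + K * W * (|B| + |C|)) (hA : |A| * l ≤ |B| * |p| + |C| * (K * X))
    (hB : |B| ≤ 2 * K * (m * Y)) (hC : |C| ≤ 2 * K * (m * Y))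
    (hC' : |C| ≤ 2 * (m * n) * Y ^ r) :
    d ≤ 4 * K ^ 2 * X ^ (2 - α) + 2 * K * 6 ^ (α - 1) * X ^ (r - (α - 1) ^ 2 - α) +
      K / c₀ * (2 * 6 ^ α * 6 ^ (α ^ 2 - r)) * X ^ (β₀ + (α - 1) * (r - α ^ 2 - 1)) := by
  have hX0 : 0 < X := by linarith
  have hY1 : 1 ≤ Y := hX.trans hXY
  have hY0 : 0 < Y := by linarith
  have hmY : m * Y ≤ Y ^ (1 - α) := by
    calc m * Y ≤ Y ^ (-α) * Y := by gcongr
      _ = Y ^ (1 - α) := by rw [← Real.rpow_add_one hY0.ne']; ring_nf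
  have hB1 : |B| ≤ 2 * K * Y ^ (1 - α) := hB.trans (by gcongr)
  have hC1 : |C| ≤ 2 * K * Y ^ (1 - α) := hC.trans (by gcongr)
  have hBC : K * W * (|B| + |C|) ≤ 4 * K ^ 2 * X ^ (2 - α) := by
    calc K * W * (|B| + |C|) ≤ K * Y * (2 * K * Y ^ (1 - α) + 2 * K * Y ^ (1 - α)) := by gcongr
      _ = 4 * K ^ 2 * (Y ^ (1 - α) * Y) := by ring
      _ = 4 * K ^ 2 * Y ^ (2 - α) := by rw [← Real.rpow_add_one hY0.ne']; ring_nf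
      _ ≤ 4 * K ^ 2 * X ^ (2 - α) := by
        gcongr 4 * K ^ 2 * ?_
        exact Real.rpow_le_rpow_of_nonpos hX0 hXY (by linarith)
  have hB2 : |B| ≤ 2 * K * (6 ^ (α - 1) * X ^ (-((α - 1) * (α - 1)))) := by
    refine hB1.trans ?_
    gcongr
    have h := rpow_neg_le_of_rpow_le (t := α - 1) hX hY0 (by linarith) hY6
    rwa [neg_sub] at h
  have hC2 : |C| ≤ 2 * 6 ^ α * 6 ^ (α ^ 2 - r) * X ^ (-((α - 1) * (α ^ 2 - r))) := by
    calc |C| ≤ 2 * (m * n) * Y ^ r := hC'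
      _ ≤ 2 * (Y ^ (-α) * (6 ^ α * Y ^ (-((α - 1) * α)))) * Y ^ r := by
        gcongr
        exact hn.trans (rpow_neg_le_of_rpow_le hY1 hZ (by linarith) hZ6)
      _ = 2 * 6 ^ α * (Y ^ (-α) * Y ^ (-((α - 1) * α)) * Y ^ r) := by ring
      _ = 2 * 6 ^ α * Y ^ (-(α ^ 2 - r)) := by
        rw [← Real.rpow_add hY0, ← Real.rpow_add hY0]
        ring_nf
      _ ≤ 2 * 6 ^ α * (6 ^ (α ^ 2 - r) * X ^ (-((α - 1) * (α ^ 2 - r)))) := by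
        gcongr
        exact rpow_neg_le_of_rpow_le hX hY0 (by linarith) hY6
      _ = _ := by ring
  have hXl : X / l ≤ X ^ (1 + β₀) / c₀ := by
    rw [div_le_div_iff₀ hl hc₀]
    have e : X ^ (1 + β₀) * X ^ (-β₀) = X := by
      rw [← Real.rpow_add hX0]
      simp
    calc X * c₀ = X ^ (1 + β₀) * (c₀ * X ^ (-β₀)) := by
          conv_lhs => rw [← e]
          ring
      _ ≤ X ^ (1 + β₀) * l := by gcongr
  have hA1 : |A| ≤ |B| * X ^ r + |C| * (K * (X ^ (1 + β₀) / c₀)) := by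
    have h1 : |A| * l ≤ (|B| * X ^ r + |C| * (K * (X / l))) * l := by
      calc |A| * l ≤ |B| * |p| + |C| * (K * X) := hA
        _ ≤ |B| * (l * X ^ r) + |C| * (K * X) := by gcongr
        _ = _ := by field_simp
    refine (le_of_mul_le_mul_right h1 hl).trans ?_
    gcongr
  have e1 : X ^ (-α) * (X ^ (-((α - 1) * (α - 1))) * X ^ r) = X ^ (r - (α - 1) ^ 2 - α) := by
    rw [← Real.rpow_add hX0, ← Real.rpow_add hX0]
    ring_nf
  have e2 : X ^ (-α) * (X ^ (-((α - 1) * (α ^ 2 - r))) * X ^ (1 + β₀)) =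
      X ^ (β₀ + (α - 1) * (r - α ^ 2 - 1)) := by
    rw [← Real.rpow_add hX0, ← Real.rpow_add hX0]
    ring_nf
  have hfin : l' * |A| ≤ 2 * K * 6 ^ (α - 1) * X ^ (r - (α - 1) ^ 2 - α) +
      K / c₀ * (2 * 6 ^ α * 6 ^ (α ^ 2 - r)) * X ^ (β₀ + (α - 1) * (r - α ^ 2 - 1)) := by
    calc l' * |A| ≤ X ^ (-α) * (2 * K * (6 ^ (α - 1) * X ^ (-((α - 1) * (α - 1)))) * X ^ r +
          2 * 6 ^ α * 6 ^ (α ^ 2 - r) * X ^ (-((α - 1) * (α ^ 2 - r))) *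
            (K * (X ^ (1 + β₀) / c₀))) := by
          gcongr
          refine hA1.trans ?_
          gcongr
      _ = _ := by
          rw [← e1, ← e2]
          ring
  linarith

lemma tendsto_const_mul_rpow_zero (M : ℝ) {s : ℝ} (hs : s < 0) :
    Filter.Tendsto (fun X : ℝ => M * X ^ s) Filter.atTop (nhds 0) := by
  have := (tendsto_rpow_neg_atTop (neg_pos.2 hs)).const_mul M
  simpa using this

lemma abs_tripleDet_le {u v w : Fin 3 → ℝ} :
    |tripleDet u v w| ≤ |u 0| * |v 1 * w 2 - v 2 * w 1| + |u 1| * |v 0 * w 2 - v 2 * w 0| +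
      |u 2| * |v 0 * w 1 - v 1 * w 0| := by
  have h := abs_add_three (u 0 * (v 1 * w 2 - v 2 * w 1)) (-(u 1 * (v 0 * w 2 - v 2 * w 0)))
    (u 2 * (v 0 * w 1 - v 1 * w 0))
  rw [abs_neg, abs_mul, abs_mul, abs_mul] at h
  simpa only [tripleDet, sub_eq_add_neg] using h

lemma abs_mul_sub_mul_le {a b c e s t : ℝ} (h1 : |a * b| ≤ s) (h2 : |c * e| ≤ t) :
    |a * b - c * e| ≤ s + t :=
  (abs_sub _ _).trans (add_le_add h1 h2)

/-- The main estimate (first part of Lemma 5): under the stated conditions, if for arbitrarily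
large `ν` there is `k > ν` such that `L_ν ≥ c₀·X_ν^{−β₀}`, the triples
`x_{ν−1}, x_ν, x_{ν+1}` and `x_{k−1}, x_k, x_{k+1}` are each linearly independent, all `x_j`
with `ν ≤ j ≤ k` lie in `ℤ³ ∩ span(x_ν, x_{ν+1})`, and `|P_ν| ≤ L_ν·X_ν^r`,
`|P_{k−1}| ≤ L_{k−1}·X_{k−1}^r`, `|P_k| ≤ L_k·X_k^r`, then `r ≥ α² + 1 − β₀/(α−1)`. -/
theorem main_estimate_lower_bound_on_r (θ₁ θ₂ : ℝ)
    (hind : ∀ a b c : ℤ, (a : ℝ) + (b : ℝ) * θ₁ + (c : ℝ) * θ₂ = 0 → a = 0 ∧ b = 0 ∧ c = 0)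
    (P F : (Fin 3 → ℝ) →ₗ[ℝ] ℝ)
    (hLPF : LinearIndependent ℝ ![Lform θ₁ θ₂, P, F])
    -- `x` is the sequence of minimal points (best approximations) of `L`:
    (x : ℕ → Fin 3 → ℤ)
    (hx0 : ∀ ν, x ν ≠ 0)
    (hLpos : ∀ ν, 0 < Lform θ₁ θ₂ (toR (x ν)))
    (hXlt : ∀ ν, enormZ (x ν) < enormZ (x (ν + 1)))
    (hLlt : ∀ ν, Lform θ₁ θ₂ (toR (x (ν + 1))) < Lform θ₁ θ₂ (toR (x ν)))
    (hbest : ∀ ν, ∀ y : Fin 3 → ℤ, y ≠ 0 → enormZ y < enormZ (x (ν + 1)) →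
      Lform θ₁ θ₂ (toR (x ν)) ≤ |Lform θ₁ θ₂ (toR y)|)
    (α r β₀ c₀ : ℝ) (hα : 2 < α) (hr0 : 0 < r) (hr : r < α ^ 2 - α + 1)
    (hβ₀ : 0 < β₀) (hc₀ : 0 < c₀)
    (hsii : ∀ j, Lform θ₁ θ₂ (toR (x j)) ≤ enormZ (x (j + 1)) ^ (-α))
    (hmain : ∀ N : ℕ, ∃ ν, N ≤ ν ∧ ∃ k, ν < k ∧
      c₀ * enormZ (x ν) ^ (-β₀) ≤ Lform θ₁ θ₂ (toR (x ν)) ∧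
      LinearIndependent ℚ ![toQ (x (ν - 1)), toQ (x ν), toQ (x (ν + 1))] ∧
      LinearIndependent ℚ ![toQ (x (k - 1)), toQ (x k), toQ (x (k + 1))] ∧
      (∀ j, ν ≤ j → j ≤ k →
        toR (x j) ∈ Submodule.span ℝ {toR (x ν), toR (x (ν + 1))}) ∧
      |P (toR (x ν))| ≤ Lform θ₁ θ₂ (toR (x ν)) * enormZ (x ν) ^ r ∧
      |P (toR (x (k - 1)))| ≤ Lform θ₁ θ₂ (toR (x (k - 1))) * enormZ (x (k - 1)) ^ r ∧
      |P (toR (x k))| ≤ Lform θ₁ θ₂ (toR (x k)) * enormZ (x k) ^ r) :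
    α ^ 2 + 1 - β₀ / (α - 1) ≤ r := by
  by_contra! hcon
  have hα1 : 0 < α - 1 := by linarith
  have hexp : β₀ + (α - 1) * (r - α ^ 2 - 1) < 0 := by
    have h1 := mul_lt_mul_of_pos_right hcon hα1
    rw [sub_mul, div_mul_cancel₀ _ hα1.ne'] at h1
    linarith
  obtain ⟨D, hD, hdet⟩ := exists_tripleDet_forms hLPF
  obtain ⟨K₁, hK₁, hPb⟩ := exists_abs_linearMap_le P
  obtain ⟨K₂, hK₂, hFb⟩ := exists_abs_linearMap_le F
  obtain ⟨K, hK, hPK, hFK⟩ : ∃ K : ℝ, 0 < K ∧ (∀ v, |P (toR v)| ≤ K * enormZ v) ∧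
      ∀ v, |F (toR v)| ≤ K * enormZ v := by
    refine ⟨K₁ + K₂, by positivity, fun v => (hPb v).trans ?_, fun v => (hFb v).trans ?_⟩ <;>
      nlinarith [Real.sqrt_nonneg ((v 0 : ℝ) ^ 2 + (v 1 : ℝ) ^ 2 + (v 2 : ℝ) ^ 2),
        show enormZ v = Real.sqrt ((v 0 : ℝ) ^ 2 + (v 1 : ℝ) ^ 2 + (v 2 : ℝ) ^ 2) from rfl]
  have hXtend := tendsto_enormZ_atTop hXlt
  have hmono : Monotone fun ν => enormZ (x ν) := monotone_nat_of_le_succ fun ν => (hXlt ν).le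
  have hanti : Antitone fun ν => Lform θ₁ θ₂ (toR (x ν)) :=
    antitone_nat_of_succ_le fun ν => (hLlt ν).le
  have hlim := (((tendsto_const_mul_rpow_zero (4 * K ^ 2) (show 2 - α < 0 by linarith)).add
    (tendsto_const_mul_rpow_zero (2 * K * 6 ^ (α - 1))
      (show r - (α - 1) ^ 2 - α < 0 by linarith))).add
    (tendsto_const_mul_rpow_zero (K / c₀ * (2 * 6 ^ α * 6 ^ (α ^ 2 - r))) hexp)).comp hXtend
  rw [add_zero, add_zero] at hlim
  obtain ⟨N, hN⟩ := Filter.eventually_atTop.1 ((hlim.eventually_lt_const (abs_pos.2 hD)).and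
    ((hXtend.eventually_ge_atTop 1).and (Filter.eventually_ge_atTop 1)))
  obtain ⟨ν, hNν, k, hνk, hLν, hindν, hindk, hspan, hPν, hPk', hPk⟩ := hmain N
  obtain ⟨hsmall, hX1, hν1⟩ := hN ν hNν
  have hgap : ∀ j, 1 ≤ j → 1 ≤ enormZ (x j) →
      LinearIndependent ℚ ![toQ (x (j - 1)), toQ (x j), toQ (x (j + 1))] →
      enormZ (x j) ^ (α - 1) ≤ 6 * enormZ (x (j + 1)) := by
    intro j hj hXj hij
    have hL : Lform θ₁ θ₂ (toR (x (j - 1))) ≤ enormZ (x j) ^ (-α) := by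
      simpa [Nat.sub_add_cancel hj] using hsii (j - 1)
    refine rpow_le_of_one_le_mul hXj (Real.sqrt_nonneg _) hL ?_
    refine (one_le_abs_tripleDet (tripleDet_toR_ne_zero hij)).trans
      (abs_tripleDet_le_of_Lform θ₁ θ₂ _ _ _ (hmono (by lia)) (hmono (by lia)) (hLpos _).le ?_ ?_)
    · rw [abs_of_pos (hLpos _)]
      exact hanti (by lia)
    · rw [abs_of_pos (hLpos _)]
      exact hanti (by lia)
  have hXYk : enormZ (x ν) ≤ enormZ (x k) := hmono hνk.le
  have hk1 : 1 ≤ enormZ (x k) := hX1.trans hXYk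
  have hY6 : enormZ (x ν) ^ (α - 1) ≤ 6 * enormZ (x k) := by
    have h1 := hgap ν hν1 hX1 hindν
    have h2 : enormZ (x (ν + 1)) ≤ enormZ (x k) := hmono hνk
    linarith
  have hZ6 := hgap k (by lia) hk1 hindk
  have hZ0 : 0 < enormZ (x (k + 1)) := by linarith [hXlt k]
  have hW : enormZ (x (k - 1)) ≤ enormZ (x k) := hmono (by lia)
  have hLk : Lform θ₁ θ₂ (toR (x k)) ≤ Lform θ₁ θ₂ (toR (x (k - 1))) := hanti (by lia)
  have hLk' : Lform θ₁ θ₂ (toR (x (k - 1))) ≤ enormZ (x k) ^ (-α) := by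
    simpa [Nat.sub_add_cancel (show 1 ≤ k by lia)] using hsii (k - 1)
  have hLν' : Lform θ₁ θ₂ (toR (x (ν - 1))) ≤ enormZ (x ν) ^ (-α) := by
    simpa [Nat.sub_add_cancel hν1] using hsii (ν - 1)
  obtain ⟨m, hm⟩ := exists_tripleDet_eq_mul (hspan (k - 1) (by lia) (by lia))
    (hspan k hνk.le le_rfl)
  have hm0 : m ≠ 0 := by
    rintro rfl
    apply tripleDet_toR_ne_zero hindk
    have h := hm (toR (x (k + 1)))
    rw [zero_mul] at h
    rw [← h]
    simp only [tripleDet]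
    ring
  have hdet1 : 1 ≤ |tripleDet (toR (x (ν - 1))) (toR (x (k - 1))) (toR (x k))| := by
    apply one_le_abs_tripleDet
    rw [hm]
    exact mul_ne_zero hm0 (tripleDet_toR_ne_zero hindν)
  have hdet0 : tripleDet (toR (x ν)) (toR (x (k - 1))) (toR (x k)) = 0 := by
    rw [hm]
    simp only [tripleDet]
    ring
  have hforms := hdet (toR (x (ν - 1))) (toR (x (k - 1))) (toR (x k))
  have hforms0 := hdet (toR (x ν)) (toR (x (k - 1))) (toR (x k))
  rw [hdet0, mul_zero] at hforms0
  have hlow : |D| ≤ |D * tripleDet (toR (x (ν - 1))) (toR (x (k - 1))) (toR (x k))| := by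
    rw [abs_mul]
    exact le_mul_of_one_le_right (abs_nonneg _) hdet1
  rw [← hforms] at hlow
  have hup := hlow.trans abs_tripleDet_le
  simp only [tripleDet, Matrix.cons_val_zero, Matrix.cons_val_one, Matrix.cons_val] at hup hforms0
  have hLk0 := hLpos k
  have hLk'0 := hLpos (k - 1)
  set l := Lform θ₁ θ₂ (toR (x k))
  set l' := Lform θ₁ θ₂ (toR (x (k - 1)))
  have hminor : ∀ f : (Fin 3 → ℝ) →ₗ[ℝ] ℝ, (∀ v, |f (toR v)| ≤ K * enormZ v) →
      |l' * f (toR (x k)) - f (toR (x (k - 1))) * l| ≤ 2 * K * (l' * enormZ (x k)) := by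
    intro f hf
    have h1 : |l' * f (toR (x k))| ≤ l' * (K * enormZ (x k)) := by
      rw [abs_mul, abs_of_pos hLk'0]
      exact mul_le_mul_of_nonneg_left (hf _) hLk'0.le
    have h2 : |f (toR (x (k - 1))) * l| ≤ (K * enormZ (x k)) * l' := by
      rw [abs_mul, abs_of_pos hLk0]
      exact mul_le_mul ((hf _).trans (by gcongr)) hLk hLk0.le (by positivity)
    linarith [abs_mul_sub_mul_le h1 h2]
  refine absurd hsmall (not_lt.2 (const_le_of_minor_bounds
    (A := P (toR (x (k - 1))) * F (toR (x k)) - F (toR (x (k - 1))) * P (toR (x k)))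
    (B := l' * F (toR (x k)) - F (toR (x (k - 1))) * l)
    (C := l' * P (toR (x k)) - P (toR (x (k - 1))) * l)
    (W := enormZ (x (ν - 1)))
    hα hr hc₀ hK hX1 hXYk (hmono (by lia)) hZ0 hY6 hZ6 hLν' hLk' hLk0.le (hsii k)
    (hLpos ν) hLν hPν ?_ ?_ (hminor F hFK) (hminor P hPK) ?_))
  · refine hup.trans ?_
    rw [abs_of_pos (hLpos (ν - 1)), mul_add, ← add_assoc]
    gcongr
    · exact hPK _
    · exact hFK _
  · rw [← abs_of_pos (hLpos ν), ← abs_mul, ← abs_mul]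
    refine le_trans (le_of_eq ?_) ((abs_sub _ (F (toR (x ν)) *
      (l' * P (toR (x k)) - P (toR (x (k - 1))) * l))).trans (add_le_add le_rfl ?_))
    · congr 1
      linear_combination hforms0
    · rw [abs_mul, mul_comm]
      exact mul_le_mul_of_nonneg_left (hFK _) (abs_nonneg _)
  · have h1 : |l' * P (toR (x k))| ≤ l' * (l * enormZ (x k) ^ r) := by
      rw [abs_mul, abs_of_pos hLk'0]
      exact mul_le_mul_of_nonneg_left hPk hLk'0.le
    have h2 : |P (toR (x (k - 1))) * l| ≤ l' * enormZ (x k) ^ r * l := by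
      rw [abs_mul, abs_of_pos hLk0]
      refine mul_le_mul_of_nonneg_right (hPk'.trans ?_) hLk0.le
      exact mul_le_mul_of_nonneg_left
        (Real.rpow_le_rpow (Real.sqrt_nonneg _) hW hr0.le) hLk'0.le
    linarith [abs_mul_sub_mul_le h1 h2]
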